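/- Let f_ρ, f_π ∈ C^0(U; (0,∞)) be two positive continuous probability densities with respect to μ, with associated probability measures ρ and π on U. Then the Knothe–Rosenblatt transport T = (T_k)_{k∈ℕ} : U → U is measurable (with respect to the product σ-algebra), bijective, and satisfies T_♯ρ = π, i.e., π(A) = ρ({y ∈ U : T(y) ∈ A}) for every measurable A ⊆ U. -/

import Mathlib

open MeasureTheory Set Filter Topology

noncomputable section

namespace SparseTransport

/-- The interval `[-1,1]` as a type. -/
abbrev II : Type := Set.Icc (-1 : ℝ) 1
instance : Nonempty II := ⟨⟨0, by norm_num⟩⟩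

/-- `U = [-1,1]^ℕ`. -/
abbrev U : Type := ℕ → II

/-- The uniform probability measure `λ/2` on `[-1,1]`. -/
def muI : Measure II := (2 : ENNReal)⁻¹ • ((volume : Measure ℝ).comap Subtype.val)

/-- The product measure `⊗_{j=1}^k λ/2` on `[-1,1]^k`. -/
def muK (k : ℕ) : Measure (Fin k → II) := Measure.pi fun _ => muI

/-- `μ` is the countable product `⊗_{j∈ℕ} λ/2` on `U`, characterized as the projective
limit of the finite-dimensional products of uniform measures. -/
def IsProductMeasure (μ : Measure U) : Prop :=
  IsProjectiveLimit μ (fun J : Finset ℕ => Measure.pi fun _ : J => muI)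

/-- Concatenation `(y_{[k]}, t)` of `y ∈ [-1,1]^k` with `t ∈ U`. -/
def concat {k : ℕ} (y : Fin k → II) (t : U) : U :=
  fun j => if h : j < k then y ⟨j, h⟩ else t (j - k)

/-- The marginal density `f̂_k(y_{[k]}) = ∫_U f(y_{[k]}, t) dμ(t)`. -/
def marginal (μ : Measure U) (f : U → ℝ) (k : ℕ) (y : Fin k → II) : ℝ :=
  ∫ t, f (concat y t) ∂μ

/-- The conditional density `f_{k+1}(y_{[k+1]}) = f̂_{k+1}(y_{[k+1]}) / f̂_k(y_{[k]})`
(`k+1` is the paper's index `k`). -/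
def condDens (μ : Measure U) (f : U → ℝ) (k : ℕ) (y : Fin (k + 1) → II) : ℝ :=
  marginal μ f (k + 1) y / marginal μ f k (fun j => y j.castSucc)

/-- `F_{k+1}(y_{[k]}, x) = ∫_{-1}^x f_{k+1}(y_{[k]}, t) dμ(t)`, the conditional CDF. -/
def condCDF' (μ : Measure U) (f : U → ℝ) (k : ℕ) (y : Fin k → II) (x : ℝ) : ℝ :=
  ∫ t : II, (if (t : ℝ) ≤ x then condDens μ f k (Fin.snoc y t) else 0) ∂muI

/-- One step of the Knothe–Rosenblatt construction:
`T_{k+1}(y_{[k]}, t) = (x ↦ F_{π,k+1}(T_{[k]}(y_{[k]}), x))^{-1} (F_{ρ,k+1}(y_{[k]}, t))`. -/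
def KRstep (μ : Measure U) (fρ fπ : U → ℝ) (k : ℕ) (yorig ytrans : Fin k → II) (t : II) : II :=
  Function.invFun (fun s : II => condCDF' μ fπ k ytrans (s : ℝ))
    (condCDF' μ fρ k yorig (t : ℝ))

/-- The first `k` components `T_{[k]}` of the KR transport. -/
def KRvec (μ : Measure U) (fρ fπ : U → ℝ) : (k : ℕ) → U → (Fin k → II)
  | 0 => fun _ => Fin.elim0
  | (k + 1) => fun x =>
      Fin.snoc (KRvec μ fρ fπ k x)
        (KRstep μ fρ fπ k (fun j : Fin k => x j) (KRvec μ fρ fπ k x) (x k))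

/-- The `k`-th component of the KR transport (`0`-based: it depends on the
coordinates `0, …, k`). -/
def KRcomp (μ : Measure U) (fρ fπ : U → ℝ) (k : ℕ) (x : U) : II :=
  KRvec μ fρ fπ (k + 1) x (Fin.last k)

/-- The Knothe–Rosenblatt transport `T : U → U` pushing `ρ` forward to `π`. -/
def KRmap (μ : Measure U) (fρ fπ : U → ℝ) (x : U) : U := fun k => KRcomp μ fρ fπ k x

/-- Replace the `k`-th coordinate of `x ∈ U` by (the projection to `[-1,1]` of) `t ∈ ℝ`. -/
def updCoord (x : U) (k : ℕ) (t : ℝ) : U :=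
  Function.update x k (Set.projIcc (-1) 1 (by norm_num) t)

/-- Partial derivative `∂_k g` of `g : U → ℝ` with respect to the `k`-th coordinate
(a derivative within `[-1,1]`). -/
def pderiv (g : U → ℝ) (k : ℕ) (x : U) : ℝ :=
  derivWithin (fun t : ℝ => g (updCoord x k t)) (Set.Icc (-1) 1) ((x k : ℝ))

/-- `∂_k T_k` for the KR transport (0-based components). -/
def pderivKR (μ : Measure U) (fρ fπ : U → ℝ) (k : ℕ) (x : U) : ℝ :=
  pderiv (fun z => (KRcomp μ fρ fπ k z : ℝ)) k x

/-- A positive continuous probability density on `U` with respect to `μ`. -/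
def IsPositiveDensity (μ : Measure U) (f : U → ℝ) : Prop :=
  Continuous f ∧ (∀ x, 0 < f x) ∧ ∫ x, f x ∂μ = 1

instance : Fact ((-1 : ℝ) ≤ 1) := ⟨by norm_num⟩

instance : PreconnectedSpace II := Subtype.preconnectedSpace isPreconnected_Icc

instance : IsProbabilityMeasure muI := by
  constructor
  rw [muI, Measure.smul_apply, comap_subtype_coe_apply measurableSet_Icc, image_univ,
    Subtype.range_coe, Real.volume_Icc]
  norm_num
  rw [ENNReal.inv_mul_cancel] <;> norm_num

instance : NullSingletonClass muI := by
  constructor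
  intro x
  rw [muI, Measure.smul_apply, comap_subtype_coe_apply measurableSet_Icc]
  simp

lemma muI_Ioc_pos {a b : II} (h : a < b) : 0 < muI (Ioc a b) := by
  have h' : Subtype.val '' Ioc a b = Ioc (a : ℝ) b := by
    ext r
    constructor
    · rintro ⟨x, hx, rfl⟩
      exact hx
    · intro hr
      exact ⟨⟨r, a.2.1.trans hr.1.le, hr.2.trans b.2.2⟩, hr, rfl⟩
  rw [muI, Measure.smul_apply, comap_subtype_coe_apply measurableSet_Icc, h', Real.volume_Ioc,
    smul_eq_mul]
  have : (a : ℝ) < b := h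
  exact ENNReal.mul_pos (by simp) (by simpa using this)

lemma IsProductMeasure.eq_infinitePi {μ : Measure U} (hμ : IsProductMeasure μ) :
    μ = Measure.infinitePi fun _ => muI :=
  hμ.unique (Measure.isProjectiveLimit_infinitePi fun _ : ℕ => muI)

lemma IsProductMeasure.isProbabilityMeasure {μ : Measure U} (hμ : IsProductMeasure μ) :
    IsProbabilityMeasure μ := by
  rw [hμ.eq_infinitePi]
  infer_instance

/-- The first `k` coordinates `x_{[k]}` of `x ∈ U`. -/
def restrictFin (k : ℕ) (x : U) : Fin k → II := fun j => x j

@[fun_prop]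
lemma measurable_restrictFin (k : ℕ) : Measurable (restrictFin k) :=
  measurable_pi_lambda _ fun _ => measurable_pi_apply _

@[fun_prop]
lemma continuous_restrictFin (k : ℕ) : Continuous (restrictFin k) :=
  continuous_pi fun _ => continuous_apply _

lemma restrictFin_concat {k : ℕ} (y : Fin k → II) (t : U) : restrictFin k (concat y t) = y := by
  ext j
  simp [restrictFin, concat]

lemma restrictFin_succ (k : ℕ) (x : U) :
    restrictFin (k + 1) x = Fin.snoc (restrictFin k x) (x k) := by
  ext j
  refine Fin.lastCases ?_ (fun i => ?_) j <;> simp [restrictFin]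

lemma concat_snoc {k : ℕ} (y : Fin k → II) (x u : U) :
    concat (Fin.snoc y (x 0) : Fin (k + 1) → II) u = concat y (concat (restrictFin 1 x) u) := by
  funext j
  rcases lt_trichotomy j k with h | h | h
  · simp [concat, h, Nat.lt_succ_of_lt h, Fin.snoc]
  · subst h
    simp [concat, Fin.snoc, restrictFin]
  · have h1 : ¬ j < k + 1 := by omega
    have h2 : ¬ j < k := by omega
    have h3 : ¬ j - k = 0 := by omega
    simp [concat, h1, h2, h3, Nat.sub_sub]

lemma continuous_concat (k : ℕ) :
    Continuous fun p : (Fin k → II) × U => concat p.1 p.2 := by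
  refine continuous_pi fun j => ?_
  by_cases h : j < k <;> simp only [concat, h, dif_pos, dif_neg, not_false_eq_true] <;> fun_prop

lemma measurable_comp_finSnoc {α β : Type*} [MeasurableSpace α] [MeasurableSpace β] {k : ℕ}
    {g : (Fin (k + 1) → II) → β} (hg : Measurable g) {y : α → Fin k → II} {t : α → II}
    (hy : Measurable y) (ht : Measurable t) : Measurable fun a => g (Fin.snoc (y a) (t a)) := by
  have : Measurable fun p : (Fin k → II) × II => (Fin.snoc p.1 p.2 : Fin (k + 1) → II) :=
    (Continuous.finSnoc continuous_fst continuous_snd).measurable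
  exact hg.comp (this.comp (hy.prodMk ht))

lemma IsProductMeasure.measurePreserving_concat {μ : Measure U} (hμ : IsProductMeasure μ) (k : ℕ) :
    MeasurePreserving (fun p : U × U => concat (restrictFin k p.1) p.2) (μ.prod μ) μ := by
  have hm : Measurable fun p : U × U => concat (restrictFin k p.1) p.2 :=
    (continuous_concat k).measurable.comp (f := fun p : U × U => (restrictFin k p.1, p.2))
      (by fun_prop)
  refine ⟨hm, ?_⟩
  obtain rfl := hμ.eq_infinitePi
  refine Measure.eq_infinitePi _ fun s A hA => ?_
  rw [Measure.map_apply hm (MeasurableSet.pi s.countable_toSet fun i _ => hA i)]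
  have : (fun p : U × U => concat (restrictFin k p.1) p.2) ⁻¹' (Set.pi s A) =
      Set.pi ({i ∈ s | i < k} : Finset ℕ) A ×ˢ
        Set.pi (({i ∈ s | ¬ i < k} : Finset ℕ).image (· - k) : Finset ℕ) fun j => A (j + k) := by
    ext ⟨x, t⟩
    simp only [mem_preimage, Set.mem_pi, mem_prod, Finset.mem_coe, Finset.mem_filter,
      Finset.mem_image]
    constructor
    · intro h
      refine ⟨fun i hi => ?_, ?_⟩
      · simpa [concat, hi.2, restrictFin] using h i hi.1
      · rintro _ ⟨i, hi, rfl⟩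
        rw [Nat.sub_add_cancel (not_lt.1 hi.2)]
        simpa [concat, hi.2] using h i hi.1
    · rintro ⟨h1, h2⟩ i hi
      by_cases hik : i < k
      · simpa [concat, hik, restrictFin] using h1 i ⟨hi, hik⟩
      · have := h2 (i - k) ⟨i, ⟨hi, hik⟩, rfl⟩
        rw [Nat.sub_add_cancel (not_lt.1 hik)] at this
        simpa [concat, hik] using this
  rw [this, Measure.prod_prod, Measure.infinitePi_pi _ fun i _ => hA i,
    Measure.infinitePi_pi _ fun i _ => hA _, Finset.prod_image,
    ← Finset.prod_filter_mul_prod_filter_not s (· < k)]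
  · congr 1
    refine Finset.prod_congr rfl fun i hi => ?_
    rw [Nat.sub_add_cancel (not_lt.1 (Finset.mem_filter.1 hi).2)]
  · intro i hi j hj hij
    have := (Finset.mem_filter.1 hi).2
    have := (Finset.mem_filter.1 hj).2
    dsimp only at hij
    omega

lemma IsProductMeasure.measurePreserving_eval {μ : Measure U} (hμ : IsProductMeasure μ) (k : ℕ) :
    MeasurePreserving (fun x : U => x k) μ muI := by
  obtain rfl := hμ.eq_infinitePi
  exact measurePreserving_eval_infinitePi (fun _ : ℕ => muI) k

lemma IsProductMeasure.lintegral_restrictFin_succ {μ : Measure U} (hμ : IsProductMeasure μ) {k : ℕ}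
    {g : (Fin (k + 1) → II) → ENNReal} (hg : Measurable g) :
    ∫⁻ x, g (restrictFin (k + 1) x) ∂μ =
      ∫⁻ x, ∫⁻ t, g (Fin.snoc (restrictFin k x) t) ∂muI ∂μ := by
  have := hμ.isProbabilityMeasure
  rw [← (hμ.measurePreserving_concat k).lintegral_comp (by fun_prop)]
  have h1 : ∀ p : U × U, restrictFin (k + 1) (concat (restrictFin k p.1) p.2) =
      Fin.snoc (restrictFin k p.1) (p.2 0) := by
    intro p
    rw [restrictFin_succ, restrictFin_concat]
    simp [concat]
  simp_rw [h1]
  rw [lintegral_prod _ (measurable_comp_finSnoc hg (by fun_prop) (by fun_prop)).aemeasurable]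
  refine lintegral_congr fun x => ?_
  exact (hμ.measurePreserving_eval 0).lintegral_comp
    (f := fun t => g (Fin.snoc (restrictFin k x) t))
    (measurable_comp_finSnoc hg measurable_const measurable_id)

/-- The cumulative distribution function of the density `h` with respect to `muI`. -/
def cdfII (h : II → ℝ) (x : II) : ℝ := ∫ t : II, (if (t : ℝ) ≤ x then h t else 0) ∂muI

lemma cdfII_eq_setIntegral (h : II → ℝ) (x : II) : cdfII h x = ∫ t in Iic x, h t ∂muI := by
  rw [cdfII, ← integral_indicator measurableSet_Iic]
  rfl

lemma continuous_cdfII {h : II → ℝ} (hc : Continuous h) : Continuous (cdfII h) := by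
  have hi : Integrable h muI := hc.integrable_of_hasCompactSupport (.of_compactSpace h)
  refine continuous_iff_continuousAt.2 fun x₀ => ?_
  refine continuousAt_of_dominated (bound := fun t => ‖h t‖) ?_ ?_ hi.norm ?_
  · exact .of_forall fun x => (hc.measurable.ite
      (measurableSet_Iic (a := x)) measurable_const).aestronglyMeasurable
  · refine .of_forall fun x => .of_forall fun t => ?_
    split_ifs <;> simp
  · have : ∀ᵐ t ∂muI, t ≠ x₀ := by simp [ae_iff]
    filter_upwards [this] with t ht
    rcases lt_or_gt_of_ne ht with h1 | h1
    · refine continuousAt_const.congr (f := fun _ => h t) ?_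
      filter_upwards [lt_mem_nhds h1] with x hx
      exact (if_pos hx.le).symm
    · refine continuousAt_const.congr (f := fun _ => (0 : ℝ)) ?_
      filter_upwards [gt_mem_nhds h1] with x hx
      exact (if_neg (not_le.2 hx)).symm

/-- A positive continuous probability density on `[-1,1]` with respect to `muI`. -/
structure IsPositiveDensityII (h : II → ℝ) : Prop where
  continuous : Continuous h
  pos : ∀ t, 0 < h t
  integral_eq_one : ∫ t, h t ∂muI = 1

lemma IsPositiveDensityII.integrable {h : II → ℝ} (hh : IsPositiveDensityII h) :
    Integrable h muI :=
  hh.continuous.integrable_of_hasCompactSupport (.of_compactSpace h)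

lemma IsPositiveDensityII.strictMono_cdfII {h : II → ℝ} (hh : IsPositiveDensityII h) :
    StrictMono (cdfII h) := by
  intro a b hab
  have hi := hh.integrable
  rw [cdfII_eq_setIntegral, cdfII_eq_setIntegral, ← Iic_union_Ioc_eq_Iic hab.le,
    setIntegral_union (Iic_disjoint_Ioc le_rfl) measurableSet_Ioc hi.integrableOn hi.integrableOn]
  refine lt_add_of_pos_right _ ?_
  rw [setIntegral_pos_iff_support_of_nonneg_ae (.of_forall fun t => (hh.pos t).le) hi.integrableOn]
  have : Function.support h = univ := eq_univ_of_forall fun t => (hh.pos t).ne'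
  rw [this, univ_inter]
  exact muI_Ioc_pos hab

lemma cdfII_bot (h : II → ℝ) : cdfII h ⊥ = 0 := by
  rw [cdfII_eq_setIntegral, Iic_bot]
  exact setIntegral_measure_zero _ (measure_singleton _)

lemma cdfII_top (h : II → ℝ) : cdfII h ⊤ = ∫ t, h t ∂muI := by
  rw [cdfII_eq_setIntegral, Iic_top, setIntegral_univ]

lemma IsPositiveDensityII.range_cdfII {h : II → ℝ} (hh : IsPositiveDensityII h) :
    range (cdfII h) = Icc 0 1 := by
  have h_bot := cdfII_bot h
  have h_top : cdfII h ⊤ = 1 := (cdfII_top h).trans hh.integral_eq_one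
  refine Subset.antisymm ?_ fun r hr => ?_
  · rintro _ ⟨x, rfl⟩
    exact ⟨h_bot.symm.trans_le (hh.strictMono_cdfII.monotone bot_le),
      (hh.strictMono_cdfII.monotone le_top).trans_eq h_top⟩
  · exact mem_range_of_exists_le_of_exists_ge (continuous_cdfII hh.continuous)
      ⟨_, h_bot.trans_le hr.1⟩ ⟨_, hr.2.trans_eq h_top.symm⟩

lemma IsPositiveDensityII.withDensity_Iic {h : II → ℝ} (hh : IsPositiveDensityII h) (x : II) :
    muI.withDensity (fun t => ENNReal.ofReal (h t)) (Iic x) = ENNReal.ofReal (cdfII h x) := by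
  have hi := hh.integrable
  rw [withDensity_apply _ measurableSet_Iic, cdfII_eq_setIntegral,
    ofReal_integral_eq_lintegral_ofReal hi.integrableOn (.of_forall fun t => (hh.pos t).le)]

/-- The monotone rearrangement of the density `h₁` into the density `h₂`. -/
def rearrangement (h₁ h₂ : II → ℝ) (t : II) : II := Function.invFun (cdfII h₂) (cdfII h₁ t)

lemma cdfII_rearrangement {h₁ h₂ : II → ℝ} (hh₁ : IsPositiveDensityII h₁)
    (hh₂ : IsPositiveDensityII h₂) (t : II) : cdfII h₂ (rearrangement h₁ h₂ t) = cdfII h₁ t :=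
  Function.invFun_eq (f := cdfII h₂) <| by
    rw [← mem_range, hh₂.range_cdfII, ← hh₁.range_cdfII]
    exact mem_range_self t

lemma rearrangement_rearrangement {h₁ h₂ : II → ℝ} (hh₁ : IsPositiveDensityII h₁)
    (hh₂ : IsPositiveDensityII h₂) (t : II) :
    rearrangement h₂ h₁ (rearrangement h₁ h₂ t) = t := by
  rw [rearrangement, cdfII_rearrangement hh₁ hh₂]
  exact Function.leftInverse_invFun hh₁.strictMono_cdfII.injective t

lemma rearrangement_le_iff {h₁ h₂ : II → ℝ} (hh₁ : IsPositiveDensityII h₁)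
    (hh₂ : IsPositiveDensityII h₂) (t a : II) :
    rearrangement h₁ h₂ t ≤ a ↔ cdfII h₁ t ≤ cdfII h₂ a := by
  rw [← hh₂.strictMono_cdfII.le_iff_le, cdfII_rearrangement hh₁ hh₂]

lemma measurable_rearrangement {h₁ h₂ : II → ℝ} (hh₁ : IsPositiveDensityII h₁)
    (hh₂ : IsPositiveDensityII h₂) : Measurable (rearrangement h₁ h₂) := by
  refine measurable_of_Iic fun a => ?_
  simp only [preimage, mem_Iic, rearrangement_le_iff hh₁ hh₂]
  exact measurableSet_le (continuous_cdfII hh₁.continuous).measurable measurable_const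

lemma map_rearrangement {h₁ h₂ : II → ℝ} (hh₁ : IsPositiveDensityII h₁)
    (hh₂ : IsPositiveDensityII h₂) :
    (muI.withDensity fun t => ENNReal.ofReal (h₁ t)).map (rearrangement h₁ h₂) =
      muI.withDensity fun t => ENNReal.ofReal (h₂ t) := by
  have hi := hh₁.integrable
  have := isFiniteMeasure_withDensity_ofReal hi.2
  refine Measure.ext_of_Iic _ _ fun a => ?_
  obtain ⟨b, hb⟩ : cdfII h₂ a ∈ range (cdfII h₁) := by
    rw [hh₁.range_cdfII, ← hh₂.range_cdfII]
    exact mem_range_self a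
  rw [Measure.map_apply (measurable_rearrangement hh₁ hh₂)
    measurableSet_Iic, hh₂.withDensity_Iic, ← hb, ← hh₁.withDensity_Iic]
  congr 1
  ext t
  rw [mem_preimage, mem_Iic, mem_Iic, rearrangement_le_iff hh₁ hh₂, ← hb,
    hh₁.strictMono_cdfII.le_iff_le]

lemma continuous_marginal {μ : Measure U} [IsFiniteMeasure μ] {f : U → ℝ} (hf : Continuous f)
    (k : ℕ) : Continuous (marginal μ f k) := by
  have : Continuous (Function.uncurry fun (y : Fin k → II) t => f (concat y t)) :=
    hf.comp (continuous_concat k)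
  have h_eq : marginal μ f k = fun y => ∫ t in univ, f (concat y t) ∂μ := by
    simp only [setIntegral_univ]
    rfl
  rw [h_eq]
  exact continuous_parametric_integral_of_continuous this isCompact_univ

lemma integrable_concat {μ : Measure U} [IsFiniteMeasure μ] {f : U → ℝ} (hf : Continuous f)
    {k : ℕ} (y : Fin k → II) : Integrable (fun t => f (concat y t)) μ := by
  have : Continuous fun t => f (concat y t) :=
    hf.comp ((continuous_concat k).comp (Continuous.prodMk_right y))
  exact this.integrable_of_hasCompactSupport (.of_compactSpace _)

lemma marginal_pos {μ : Measure U} [IsProbabilityMeasure μ] {f : U → ℝ} (hf : Continuous f)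
    (hpos : ∀ x, 0 < f x) {k : ℕ} (y : Fin k → II) : 0 < marginal μ f k y := by
  rw [marginal, integral_pos_iff_support_of_nonneg (fun _ => (hpos _).le) (integrable_concat hf y)]
  have : Function.support (fun t => f (concat y t)) = univ :=
    eq_univ_of_forall fun t => (hpos _).ne'
  simp [this]

lemma integral_marginal_snoc {μ : Measure U} (hμ : IsProductMeasure μ) {f : U → ℝ}
    (hf : Continuous f) {k : ℕ} (y : Fin k → II) :
    ∫ t, marginal μ f (k + 1) (Fin.snoc y t) ∂muI = marginal μ f k y := by
  have := hμ.isProbabilityMeasure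
  have hc : Continuous fun t => f (concat y t) :=
    hf.comp ((continuous_concat k).comp (Continuous.prodMk_right y))
  have hc' : Continuous fun p : U × U => f (concat y (concat (restrictFin 1 p.1) p.2)) :=
    hc.comp ((continuous_concat 1).comp (f := fun p : U × U => (restrictFin 1 p.1, p.2))
      (by fun_prop))
  have hs : Continuous fun t => marginal μ f (k + 1) (Fin.snoc y t : Fin (k + 1) → II) :=
    (continuous_marginal hf _).comp (Continuous.finSnoc continuous_const continuous_id)
  have h_law : MeasurePreserving (fun p : U × U => concat (restrictFin 1 p.1) p.2) (μ.prod μ) μ :=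
    hμ.measurePreserving_concat 1
  have h_eval : MeasurePreserving (fun x : U => x 0) μ muI := hμ.measurePreserving_eval 0
  calc ∫ t, marginal μ f (k + 1) (Fin.snoc y t) ∂muI
      = ∫ x, marginal μ f (k + 1) (Fin.snoc y (x 0)) ∂μ := by
        rw [← h_eval.map_eq]
        exact integral_map h_eval.measurable.aemeasurable hs.aestronglyMeasurable
    _ = ∫ x, ∫ u, f (concat y (concat (restrictFin 1 x) u)) ∂μ ∂μ := by
        simp_rw [marginal, concat_snoc]
    _ = ∫ p : U × U, f (concat y (concat (restrictFin 1 p.1) p.2)) ∂μ.prod μ :=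
        (integral_prod _ (hc'.integrable_of_hasCompactSupport (.of_compactSpace _))).symm
    _ = marginal μ f k y := by
        rw [marginal, ← integral_map h_law.measurable.aemeasurable
          (f := fun t => f (concat y t)) hc.aestronglyMeasurable, h_law.map_eq]

lemma continuous_condDens {μ : Measure U} [IsProbabilityMeasure μ] {f : U → ℝ}
    (hf : Continuous f) (hpos : ∀ x, 0 < f x) (k : ℕ) : Continuous (condDens μ f k) :=
  (continuous_marginal hf _).div
    ((continuous_marginal hf _).comp (continuous_pi fun _ => continuous_apply _))
    fun _ => (marginal_pos hf hpos _).ne'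

lemma marginal_mul_condDens_snoc {μ : Measure U} [IsProbabilityMeasure μ] {f : U → ℝ}
    (hf : Continuous f) (hpos : ∀ x, 0 < f x) {k : ℕ} (y : Fin k → II) (t : II) :
    marginal μ f k y * condDens μ f k (Fin.snoc y t) = marginal μ f (k + 1) (Fin.snoc y t) := by
  simp only [condDens, Fin.snoc_castSucc]
  exact mul_div_cancel₀ _ (marginal_pos hf hpos y).ne'

lemma isPositiveDensityII_condDens {μ : Measure U} (hμ : IsProductMeasure μ) {f : U → ℝ}
    (hf : IsPositiveDensity μ f) {k : ℕ} (y : Fin k → II) :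
    IsPositiveDensityII fun t => condDens μ f k (Fin.snoc y t) := by
  have := hμ.isProbabilityMeasure
  refine ⟨(continuous_condDens hf.1 hf.2.1 k).comp
    (Continuous.finSnoc continuous_const continuous_id),
    fun t => div_pos (marginal_pos hf.1 hf.2.1 _) (marginal_pos hf.1 hf.2.1 _), ?_⟩
  simp only [condDens, Fin.snoc_castSucc]
  rw [integral_div, integral_marginal_snoc hμ hf.1, div_self (marginal_pos hf.1 hf.2.1 y).ne']

lemma measurable_condCDF' {μ : Measure U} (hμ : IsProductMeasure μ) {f : U → ℝ}
    (hf : IsPositiveDensity μ f) (k : ℕ) :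
    Measurable fun p : (Fin k → II) × II => condCDF' μ f k p.1 p.2 := by
  have := hμ.isProbabilityMeasure
  refine StronglyMeasurable.measurable (StronglyMeasurable.integral_prod_right (f :=
    fun (p : (Fin k → II) × II) (t : II) =>
      if (t : ℝ) ≤ p.2 then condDens μ f k (Fin.snoc p.1 t) else 0) ?_)
  refine Measurable.stronglyMeasurable (Measurable.ite ?_ ?_ measurable_const)
  · exact measurableSet_le (by fun_prop) (by fun_prop)
  · exact measurable_comp_finSnoc (continuous_condDens hf.1 hf.2.1 k).measurable (by fun_prop)
      (by fun_prop)

lemma measurable_KRstep {α : Type*} [MeasurableSpace α] {μ : Measure U} (hμ : IsProductMeasure μ)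
    {fρ fπ : U → ℝ} (hρ : IsPositiveDensity μ fρ) (hπ : IsPositiveDensity μ fπ) {k : ℕ}
    {y z : α → Fin k → II} {t : α → II} (hy : Measurable y) (hz : Measurable z)
    (ht : Measurable t) : Measurable fun a => KRstep μ fρ fπ k (y a) (z a) (t a) := by
  refine measurable_of_Iic fun s => ?_
  have h (a : α) : KRstep μ fρ fπ k (y a) (z a) (t a) ≤ s ↔
      condCDF' μ fρ k (y a) (t a) ≤ condCDF' μ fπ k (z a) s :=
    rearrangement_le_iff (isPositiveDensityII_condDens hμ hρ (y a))
      (isPositiveDensityII_condDens hμ hπ (z a)) (t a) s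
  simp only [preimage, mem_Iic, h]
  exact measurableSet_le ((measurable_condCDF' hμ hρ k).comp (hy.prodMk ht))
    ((measurable_condCDF' hμ hπ k).comp (f := fun a => (z a, s)) (hz.prodMk measurable_const))

lemma KRvec_succ (μ : Measure U) (fρ fπ : U → ℝ) (k : ℕ) (x : U) :
    KRvec μ fρ fπ (k + 1) x = Fin.snoc (KRvec μ fρ fπ k x)
      (KRstep μ fρ fπ k (restrictFin k x) (KRvec μ fρ fπ k x) (x k)) := rfl

lemma KRmap_apply (μ : Measure U) (fρ fπ : U → ℝ) (x : U) (k : ℕ) :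
    KRmap μ fρ fπ x k =
      KRstep μ fρ fπ k (restrictFin k x) (KRvec μ fρ fπ k x) (x k) := by
  rw [KRmap, KRcomp, KRvec_succ, Fin.snoc_last]

lemma restrictFin_KRmap (μ : Measure U) (fρ fπ : U → ℝ) (k : ℕ) (x : U) :
    restrictFin k (KRmap μ fρ fπ x) = KRvec μ fρ fπ k x := by
  induction k with
  | zero => exact Subsingleton.elim _ _
  | succ k ih => rw [restrictFin_succ, ih, KRmap_apply, KRvec_succ]

lemma KRvec_congr (μ : Measure U) (fρ fπ : U → ℝ) (k : ℕ) {x x' : U}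
    (h : restrictFin k x = restrictFin k x') : KRvec μ fρ fπ k x = KRvec μ fρ fπ k x' := by
  induction k with
  | zero => rfl
  | succ k ih =>
    rw [restrictFin_succ, restrictFin_succ, Fin.snoc_inj] at h
    rw [KRvec_succ, KRvec_succ, ih h.1, h.1, h.2]

lemma measurable_KRvec {μ : Measure U} (hμ : IsProductMeasure μ) {fρ fπ : U → ℝ}
    (hρ : IsPositiveDensity μ fρ) (hπ : IsPositiveDensity μ fπ) (k : ℕ) :
    Measurable (KRvec μ fρ fπ k) := by
  induction k with
  | zero => exact measurable_const
  | succ k ih =>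
    exact measurable_comp_finSnoc measurable_id ih
      (measurable_KRstep hμ hρ hπ (measurable_restrictFin k) ih (measurable_pi_apply k))

lemma measurable_KRmap {μ : Measure U} (hμ : IsProductMeasure μ) {fρ fπ : U → ℝ}
    (hρ : IsPositiveDensity μ fρ) (hπ : IsPositiveDensity μ fπ) :
    Measurable (KRmap μ fρ fπ) :=
  measurable_pi_lambda _ fun k =>
    (measurable_pi_apply (Fin.last k)).comp (measurable_KRvec hμ hρ hπ (k + 1))

lemma KRmap_KRmap {μ : Measure U} (hμ : IsProductMeasure μ) {fρ fπ : U → ℝ}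
    (hρ : IsPositiveDensity μ fρ) (hπ : IsPositiveDensity μ fπ) (x : U) :
    KRmap μ fπ fρ (KRmap μ fρ fπ x) = x := by
  have h_step (k : ℕ) (y z : Fin k → II) (t : II) :
      KRstep μ fπ fρ k z y (KRstep μ fρ fπ k y z t) = t :=
    rearrangement_rearrangement (isPositiveDensityII_condDens hμ hρ y)
      (isPositiveDensityII_condDens hμ hπ z) t
  have h_vec (k : ℕ) : KRvec μ fπ fρ k (KRmap μ fρ fπ x) = restrictFin k x := by
    induction k with
    | zero => exact Subsingleton.elim _ _
    | succ k ih =>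
      rw [KRvec_succ, ih, restrictFin_KRmap, KRmap_apply, h_step, restrictFin_succ]
  funext k
  rw [KRmap_apply, h_vec, restrictFin_KRmap, KRmap_apply, h_step]

lemma lintegral_restrictFin_mul_density {μ : Measure U} (hμ : IsProductMeasure μ) {f : U → ℝ}
    (hf : IsPositiveDensity μ f) {k : ℕ} {g : (Fin k → II) → ENNReal} (hg : Measurable g) :
    ∫⁻ x, g (restrictFin k x) * ENNReal.ofReal (f x) ∂μ =
      ∫⁻ x, g (restrictFin k x) * ENNReal.ofReal (marginal μ f k (restrictFin k x)) ∂μ := by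
  have := hμ.isProbabilityMeasure
  have hfm := hf.1.measurable
  have hm := (hμ.measurePreserving_concat k).measurable
  rw [← (hμ.measurePreserving_concat k).lintegral_comp (by fun_prop),
    lintegral_prod _ (by fun_prop)]
  refine lintegral_congr fun x => ?_
  have hx : Measurable fun t => f (concat (restrictFin k x) t) :=
    hfm.comp (hm.comp (measurable_prodMk_left (x := x)))
  simp only [restrictFin_concat]
  rw [lintegral_const_mul _ hx.ennreal_ofReal, marginal,
    ofReal_integral_eq_lintegral_ofReal (integrable_concat hf.1 _)
      (.of_forall fun t => (hf.2.1 _).le)]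

/-- The conditional distribution with density `condDens μ f k (y, ·)`. -/
def condMeasure (μ : Measure U) (f : U → ℝ) (k : ℕ) (y : Fin k → II) : Measure II :=
  muI.withDensity fun t => ENNReal.ofReal (condDens μ f k (Fin.snoc y t))

lemma lintegral_condMeasure {μ : Measure U} (hμ : IsProductMeasure μ) {f : U → ℝ}
    (hf : IsPositiveDensity μ f) {k : ℕ} (y : Fin k → II) {g : II → ENNReal}
    (hg : Measurable g) :
    ∫⁻ t, g t ∂condMeasure μ f k y =
      ∫⁻ t, ENNReal.ofReal (condDens μ f k (Fin.snoc y t)) * g t ∂muI :=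
  lintegral_withDensity_eq_lintegral_mul _
    (isPositiveDensityII_condDens hμ hf y).continuous.measurable.ennreal_ofReal hg

lemma measurable_lintegral_condMeasure {μ : Measure U} (hμ : IsProductMeasure μ) {f : U → ℝ}
    (hf : IsPositiveDensity μ f) {k : ℕ} {g : (Fin (k + 1) → II) → ENNReal} (hg : Measurable g) :
    Measurable fun y : Fin k → II => ∫⁻ t, g (Fin.snoc y t) ∂condMeasure μ f k y := by
  have := hμ.isProbabilityMeasure
  have h_eq : (fun y : Fin k → II => ∫⁻ t, g (Fin.snoc y t) ∂condMeasure μ f k y) = fun y =>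
      ∫⁻ t, ENNReal.ofReal (condDens μ f k (Fin.snoc y t)) * g (Fin.snoc y t) ∂muI :=
    funext fun y => lintegral_condMeasure hμ hf y
      (measurable_comp_finSnoc hg measurable_const measurable_id)
  rw [h_eq]
  refine Measurable.lintegral_prod_right (f := fun (y : Fin k → II) (t : II) =>
    ENNReal.ofReal (condDens μ f k (Fin.snoc y t)) * g (Fin.snoc y t)) ?_
  exact (measurable_comp_finSnoc (continuous_condDens hf.1 hf.2.1 k).measurable measurable_fst
    measurable_snd).ennreal_ofReal.mul (measurable_comp_finSnoc hg measurable_fst measurable_snd)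

lemma lintegral_restrictFin_succ_mul_density {μ : Measure U} (hμ : IsProductMeasure μ) {f : U → ℝ}
    (hf : IsPositiveDensity μ f) {k : ℕ} {g : (Fin (k + 1) → II) → ENNReal} (hg : Measurable g) :
    ∫⁻ x, g (restrictFin (k + 1) x) * ENNReal.ofReal (f x) ∂μ =
      ∫⁻ x, (∫⁻ t, g (Fin.snoc (restrictFin k x) t) ∂condMeasure μ f k (restrictFin k x)) *
          ENNReal.ofReal (f x) ∂μ := by
  have := hμ.isProbabilityMeasure
  have hmarg := (continuous_marginal (μ := μ) hf.1 (k + 1)).measurable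
  rw [lintegral_restrictFin_mul_density hμ hf hg,
    lintegral_restrictFin_mul_density hμ hf (measurable_lintegral_condMeasure hμ hf hg),
    hμ.lintegral_restrictFin_succ (g := fun y => g y * ENNReal.ofReal (marginal μ f (k + 1) y))
      (by fun_prop)]
  refine lintegral_congr fun x => ?_
  have hgx : Measurable fun t => g (Fin.snoc (restrictFin k x) t) :=
    measurable_comp_finSnoc hg measurable_const measurable_id
  have hcx := (isPositiveDensityII_condDens hμ hf (restrictFin k x)).continuous.measurable
  rw [lintegral_condMeasure hμ hf _ hgx, ← lintegral_mul_const _ (by fun_prop)]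
  refine lintegral_congr fun t => ?_
  rw [← marginal_mul_condDens_snoc hf.1 hf.2.1,
    ENNReal.ofReal_mul (marginal_pos hf.1 hf.2.1 _).le]
  ring

lemma map_KRstep_condMeasure {μ : Measure U} (hμ : IsProductMeasure μ) {fρ fπ : U → ℝ}
    (hρ : IsPositiveDensity μ fρ) (hπ : IsPositiveDensity μ fπ) {k : ℕ} (y z : Fin k → II) :
    (condMeasure μ fρ k y).map (KRstep μ fρ fπ k y z) = condMeasure μ fπ k z :=
  map_rearrangement (isPositiveDensityII_condDens hμ hρ y) (isPositiveDensityII_condDens hμ hπ z)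

lemma lintegral_KRvec {μ : Measure U} (hμ : IsProductMeasure μ) {fρ fπ : U → ℝ}
    (hρ : IsPositiveDensity μ fρ) (hπ : IsPositiveDensity μ fπ) (k : ℕ)
    {g : (Fin k → II) → ENNReal} (hg : Measurable g) :
    ∫⁻ x, g (KRvec μ fρ fπ k x) * ENNReal.ofReal (fρ x) ∂μ =
      ∫⁻ x, g (restrictFin k x) * ENNReal.ofReal (fπ x) ∂μ := by
  have := hμ.isProbabilityMeasure
  induction k with
  | zero =>
    have h_one {f : U → ℝ} (hf : IsPositiveDensity μ f) : ∫⁻ x, ENNReal.ofReal (f x) ∂μ = 1 := by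
      rw [← ofReal_integral_eq_lintegral_ofReal
        (hf.1.integrable_of_hasCompactSupport (.of_compactSpace f))
        (.of_forall fun x => (hf.2.1 x).le), hf.2.2, ENNReal.ofReal_one]
    have h_const (y : Fin 0 → II) : g y = g Fin.elim0 := congrArg g (Subsingleton.elim _ _)
    simp_rw [h_const]
    rw [lintegral_const_mul _ hρ.1.measurable.ennreal_ofReal,
      lintegral_const_mul _ hπ.1.measurable.ennreal_ofReal, h_one hρ, h_one hπ]
  | succ k ih =>
    obtain ⟨t₀⟩ : Nonempty U := inferInstance
    let V : (Fin k → II) → (Fin k → II) := fun y => KRvec μ fρ fπ k (concat y t₀)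
    have hV (x : U) : KRvec μ fρ fπ k x = V (restrictFin k x) :=
      KRvec_congr μ fρ fπ k (restrictFin_concat _ _).symm
    have hVm : Measurable V := (measurable_KRvec hμ hρ hπ k).comp
      ((continuous_concat k).measurable.comp (f := fun y => (y, t₀)) (by fun_prop))
    let G : (Fin (k + 1) → II) → ENNReal := fun y => g (Fin.snoc (V fun j => y j.castSucc)
      (KRstep μ fρ fπ k (fun j => y j.castSucc) (V fun j => y j.castSucc) (y (Fin.last k))))
    have hVm' : Measurable fun y : Fin (k + 1) → II => V fun j => y j.castSucc :=
      hVm.comp (by fun_prop)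
    have hG : Measurable G := measurable_comp_finSnoc hg hVm'
      (measurable_KRstep hμ hρ hπ (by fun_prop) hVm' (measurable_pi_apply _))
    have hG_snoc (y : Fin k → II) (t : II) :
        G (Fin.snoc y t) = g (Fin.snoc (V y) (KRstep μ fρ fπ k y (V y) t)) := by simp [G]
    have h_left (x : U) : g (KRvec μ fρ fπ (k + 1) x) = G (restrictFin (k + 1) x) := by
      rw [restrictFin_succ, hG_snoc, KRvec_succ, hV]
    simp_rw [h_left]
    rw [lintegral_restrictFin_succ_mul_density hμ hρ hG,
      lintegral_restrictFin_succ_mul_density hμ hπ hg,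
      ← ih (measurable_lintegral_condMeasure hμ hπ hg)]
    refine lintegral_congr fun x => ?_
    congr 1
    simp_rw [hG_snoc, hV]
    rw [← map_KRstep_condMeasure hμ hρ hπ (restrictFin k x) (V (restrictFin k x)),
      lintegral_map (f := fun t => g (Fin.snoc (V (restrictFin k x)) t))
        (g := KRstep μ fρ fπ k (restrictFin k x) (V (restrictFin k x)))
        (measurable_comp_finSnoc hg measurable_const measurable_id)
        (measurable_KRstep hμ hρ hπ measurable_const measurable_const measurable_id)]

lemma ext_of_map_restrictFin {ν₁ ν₂ : Measure U} [IsFiniteMeasure ν₂]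
    (h : ∀ k, ν₁.map (restrictFin k) = ν₂.map (restrictFin k)) : ν₁ = ν₂ := by
  refine IsProjectiveLimit.unique (P := fun J : Finset ℕ => ν₂.map J.restrict) (fun J => ?_)
    fun J => rfl
  let φ : (Fin (J.sup id + 1) → II) → J → II := fun y j =>
    y ⟨j, Nat.lt_succ_of_le (Finset.le_sup (f := id) j.2)⟩
  have hφ : Measurable φ := by fun_prop
  have h_comp : J.restrict = φ ∘ restrictFin (J.sup id + 1) := rfl
  dsimp only
  rw [h_comp, ← Measure.map_map hφ (measurable_restrictFin _),
    ← Measure.map_map hφ (measurable_restrictFin _), h]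

/-- Theorem `THM:KNOTHEINF`, part (1).  Let `f_ρ, f_π` be positive
continuous probability densities w.r.t. the product measure `μ` on `U`, with associated
measures `ρ = f_ρ μ` and `π = f_π μ`.  Then the Knothe–Rosenblatt transport
`T : U → U` is measurable, bijective and pushes `ρ` forward to `π`. -/
theorem KR_measurable_bijective_pushforward
    (μ : Measure U) (hμ : IsProductMeasure μ)
    (fρ fπ : U → ℝ) (hρ : IsPositiveDensity μ fρ) (hπ : IsPositiveDensity μ fπ) :
    Measurable (KRmap μ fρ fπ) ∧
    Function.Bijective (KRmap μ fρ fπ) ∧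
    (μ.withDensity fun x => ENNReal.ofReal (fρ x)).map (KRmap μ fρ fπ) =
      μ.withDensity fun x => ENNReal.ofReal (fπ x) := by
  have := hμ.isProbabilityMeasure
  have hT := measurable_KRmap hμ hρ hπ
  refine ⟨hT, ⟨Function.LeftInverse.injective (KRmap_KRmap hμ hρ hπ),
    Function.RightInverse.surjective (KRmap_KRmap hμ hπ hρ)⟩, ?_⟩
  have hint : Integrable fπ μ :=
    hπ.1.integrable_of_hasCompactSupport (.of_compactSpace fπ)
  have := isFiniteMeasure_withDensity_ofReal hint.2
  refine ext_of_map_restrictFin fun k => Measure.ext_of_lintegral _ fun g hg => ?_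
  have h_weight {f : U → ℝ} (hf : IsPositiveDensity μ f) {φ : U → ENNReal} (hφ : Measurable φ) :
      ∫⁻ x, φ x ∂μ.withDensity (fun x => ENNReal.ofReal (f x)) =
        ∫⁻ x, φ x * ENNReal.ofReal (f x) ∂μ := by
    rw [lintegral_withDensity_eq_lintegral_mul _ hf.1.measurable.ennreal_ofReal hφ]
    simp only [Pi.mul_apply, mul_comm]
  rw [lintegral_map hg (measurable_restrictFin k), lintegral_map hg (measurable_restrictFin k),
    lintegral_map (f := fun x => g (restrictFin k x)) (by fun_prop) hT, h_weight hπ (by fun_prop),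
    h_weight hρ (by fun_prop), ← lintegral_KRvec hμ hρ hπ k hg]
  simp_rw [restrictFin_KRmap]

end SparseTransport
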